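/- Let d ≥ 1 and let K̃ : ℝ^d → ℝ be four times continuously differentiable with compact support and not identically zero. With K := ΔK̃, the following inequality holds: 2 ∫₀^∞ ‖∇(q_{s/2} * K̃)‖⁴_{L²(ℝ^d)} ds ≥ ‖∇K̃‖⁴_{L²(ℝ^d)} · ‖K‖²_{L²(ℝ^d)} / ‖∇K‖²_{L²(ℝ^d)} (equivalently, with T > 0, Σ^P := (4/T)‖∇K̃‖^{−4}_{L²} ∫₀^∞ ‖∇(q_{s/2} * K̃)‖⁴_{L²} ds satisfies Σ^P ≥ Σ^A := (2/T)‖K‖²_{L²}/‖∇K‖²_{L²}). -/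

import Mathlib

open MeasureTheory Real Filter Topology
open scoped InnerProductSpace

noncomputable section

/-- Gaussian heat kernel `q_t(x) = (4πt)^{-d/2} exp(-|x|²/(4t))` on ℝ^d. -/
def heatK (d : ℕ) (t : ℝ) (x : EuclideanSpace ℝ (Fin d)) : ℝ :=
  (4 * π * t) ^ (-(d : ℝ) / 2) * Real.exp (-‖x‖ ^ 2 / (4 * t))

/-- Heat semigroup acting by convolution: `e^{tΔ}u = q_t * u`. -/
def heatConv {d : ℕ} (t : ℝ) (u : EuclideanSpace ℝ (Fin d) → ℝ)
    (x : EuclideanSpace ℝ (Fin d)) : ℝ :=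
  ∫ y, heatK d t (x - y) * u y

/-- `i`-th partial derivative `∂ᵢ f`. -/
def pd {d : ℕ} (i : Fin d) (f : EuclideanSpace ℝ (Fin d) → ℝ)
    (x : EuclideanSpace ℝ (Fin d)) : ℝ :=
  fderiv ℝ f x (EuclideanSpace.single i 1)

/-- Laplacian `Δf = Σᵢ ∂ᵢ∂ᵢ f`. -/
def lap {d : ℕ} (f : EuclideanSpace ℝ (Fin d) → ℝ)
    (x : EuclideanSpace ℝ (Fin d)) : ℝ :=
  ∑ i : Fin d, pd i (pd i f) x

/-- Divergence of a vector field `div F = Σᵢ ∂ᵢ Fᵢ`. -/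
def divg {d : ℕ} (F : EuclideanSpace ℝ (Fin d) → EuclideanSpace ℝ (Fin d))
    (x : EuclideanSpace ℝ (Fin d)) : ℝ :=
  ∑ i : Fin d, fderiv ℝ (fun y => F y i) x (EuclideanSpace.single i 1)

/-- `L²` norm `(∫ u²)^{1/2}`. -/
def l2n {d : ℕ} (u : EuclideanSpace ℝ (Fin d) → ℝ) : ℝ :=
  (∫ x, (u x) ^ 2) ^ (1 / 2 : ℝ)

/-- `L¹` norm `∫ |u|`. -/
def l1n {d : ℕ} (u : EuclideanSpace ℝ (Fin d) → ℝ) : ℝ := ∫ x, |u x|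

/-- `L¹∩L²` norm `‖u‖_{L¹} + ‖u‖_{L²}`. -/
def l12n {d : ℕ} (u : EuclideanSpace ℝ (Fin d) → ℝ) : ℝ := l1n u + l2n u

/-- `W²_{1,2}` norm `‖z‖_{L¹∩L²} + ‖|∇z|‖_{L¹∩L²} + ‖Δz‖_{L¹∩L²}`. -/
def w2n {d : ℕ} (z : EuclideanSpace ℝ (Fin d) → ℝ) : ℝ :=
  l12n z + l12n (fun x => ‖gradient z x‖) + l12n (lap z)

open FourierTransform SchwartzMap

/-- The `L²` Fourier transform agrees almost everywhere with the Fourier integral on `L¹ ∩ L²`. -/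
theorem coeFn_fourier_toLp_ae_eq {E : Type*} [NormedAddCommGroup E] [InnerProductSpace ℝ E]
    [FiniteDimensional ℝ E] [MeasurableSpace E] [BorelSpace E]
    {u : E → ℂ} (hu : Integrable u) (hu2 : MemLp u 2) :
    ((𝓕 (hu2.toLp u) : Lp ℂ 2 (volume : Measure E)) : E → ℂ) =ᵐ[volume] 𝓕 u := by
  have hcont : Continuous (𝓕 u) :=
    VectorFourier.fourierIntegral_continuous Real.continuous_fourierChar
      (by simpa using continuous_inner) hu
  refine ae_eq_of_integral_contDiff_smul_eq
    ((Lp.memLp _).locallyIntegrable (by norm_num)) hcont.locallyIntegrable ?_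
  intro g hg hgs
  have hg' : ContDiff ℝ (⊤ : ℕ∞) (fun x => (g x : ℂ)) :=
    Complex.ofRealCLM.contDiff.comp hg
  have hgs' : HasCompactSupport (fun x => (g x : ℂ)) :=
    hgs.comp_left (g := fun r : ℝ => (r : ℂ)) (by simp)
  set φ : 𝓢(E, ℂ) := hgs'.toSchwartzMap hg'
  have hφx : ∀ x, φ x = (g x : ℂ) := fun x => rfl
  have h := congrArg (fun T => T φ) (Lp.fourier_toTemperedDistribution_eq (hu2.toLp u))
  simp only [TemperedDistribution.fourier_apply, Lp.toTemperedDistribution_apply] at h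
  have h1 : ∫ x, (𝓕 φ) x • (hu2.toLp u : E → ℂ) x = ∫ x, (𝓕 φ) x • u x := by
    refine integral_congr_ae ?_
    filter_upwards [hu2.coeFn_toLp] with x hx
    rw [hx]
  have h2 : ∫ x, (𝓕 φ) x • u x = ∫ x, φ x • (𝓕 u) x := by
    have := VectorFourier.integral_fourierIntegral_smul_eq_flip (μ := (volume : Measure E))
      (ν := (volume : Measure E)) (f := (φ : E → ℂ)) (g := u) (L := innerₗ E)
      Real.continuous_fourierChar (by simpa using continuous_inner) φ.integrable hu
    rw [flip_innerₗ] at this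
    exact this
  calc ∫ x, g x • ((𝓕 (hu2.toLp u) : Lp ℂ 2 (volume : Measure E)) : E → ℂ) x
      = ∫ x, φ x • ((𝓕 (hu2.toLp u) : Lp ℂ 2 (volume : Measure E)) : E → ℂ) x := by
        simp [hφx]
    _ = ∫ x, φ x • (𝓕 u) x := by rw [← h, h1, h2]
    _ = _ := by simp [hφx]

/-- Plancherel's theorem for functions in `L¹ ∩ L²`. -/
theorem integral_norm_sq_fourier {E : Type*} [NormedAddCommGroup E] [InnerProductSpace ℝ E]
    [FiniteDimensional ℝ E] [MeasurableSpace E] [BorelSpace E]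
    {u : E → ℂ} (hu : Integrable u) (hu2 : MemLp u 2) :
    Integrable (fun ξ => ‖𝓕 u ξ‖ ^ 2) ∧ ∫ ξ, ‖𝓕 u ξ‖ ^ 2 = ∫ x, ‖u x‖ ^ 2 := by
  have hae := coeFn_fourier_toLp_ae_eq hu hu2
  have hF : MemLp (𝓕 u) 2 := (Lp.memLp _).ae_eq hae
  refine ⟨(memLp_two_iff_integrable_sq_norm hF.1).1 hF, ?_⟩
  have key : ∀ v : Lp ℂ 2 (volume : Measure E), ‖v‖ ^ 2 = ∫ x, ‖v x‖ ^ 2 := by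
    intro v
    have h := L2.inner_def (𝕜 := ℂ) v v
    rw [inner_self_eq_norm_sq_to_K] at h
    simp only [inner_self_eq_norm_sq_to_K] at h
    have h' : ((‖v‖ ^ 2 : ℝ) : ℂ) = ((∫ x, ‖v x‖ ^ 2 : ℝ) : ℂ) := by
      rw [← integral_complex_ofReal]
      simpa using h
    exact_mod_cast h'
  have h := Lp.norm_fourier_eq (hu2.toLp u)
  have h1 := key (𝓕 (hu2.toLp u))
  have h2 := key (hu2.toLp u)
  rw [h, h2] at h1
  have e1 : ∫ x, ‖(hu2.toLp u : E → ℂ) x‖ ^ 2 = ∫ x, ‖u x‖ ^ 2 :=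
    integral_congr_ae (hu2.coeFn_toLp.mono fun x hx => by simp only [hx])
  have e2 : ∫ x, ‖((𝓕 (hu2.toLp u) : Lp ℂ 2 (volume : Measure E)) : E → ℂ) x‖ ^ 2 = ∫ x, ‖𝓕 u x‖ ^ 2 :=
    integral_congr_ae (hae.mono fun x hx => by simp only [hx])
  rw [← e1, ← e2, h1]

section FourierMultipliers

variable {d : ℕ}

local notation "𝔼" => EuclideanSpace ℝ (Fin d)

/-- The Fourier transform of a real-valued function. -/
def realFourier (u : 𝔼 → ℝ) (ξ : 𝔼) : ℂ := 𝓕 (fun x => (u x : ℂ)) ξ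

theorem plancherel_real {u : 𝔼 → ℝ} (hu : Integrable u) (hu2 : MemLp u 2) :
    Integrable (fun ξ => ‖realFourier u ξ‖ ^ 2) ∧
      ∫ ξ, ‖realFourier u ξ‖ ^ 2 = ∫ x, u x ^ 2 := by
  have h := integral_norm_sq_fourier (u := fun x => (u x : ℂ)) hu.ofReal hu2.ofReal
  simpa [realFourier] using h

theorem HasCompactSupport.pd {u : 𝔼 → ℝ} (hu : HasCompactSupport u) (i : Fin d) :
    HasCompactSupport (pd i u) :=
  hu.fderiv_apply ℝ _

theorem ContDiff.pd {u : 𝔼 → ℝ} {n m : WithTop ℕ∞} (hu : ContDiff ℝ n u) (hmn : m + 1 ≤ n)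
    (i : Fin d) : ContDiff ℝ m (pd i u) :=
  (hu.fderiv_right hmn).clm_apply contDiff_const

theorem ContDiff.lap {u : 𝔼 → ℝ} {n m : WithTop ℕ∞} (hu : ContDiff ℝ n u) (hmn : m + 1 + 1 ≤ n) :
    ContDiff ℝ m (lap u) :=
  ContDiff.sum fun i _ => (hu.pd hmn i).pd le_rfl i

theorem HasCompactSupport.lap {u : 𝔼 → ℝ} (hu : HasCompactSupport u) :
    HasCompactSupport (lap u) := by
  have h : ∀ s : Finset (Fin d),
      HasCompactSupport (fun x => ∑ i ∈ s, _root_.pd i (_root_.pd i u) x) := by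
    intro s
    induction s using Finset.cons_induction with
    | empty => exact HasCompactSupport.zero
    | cons a s ha ih =>
      simp only [Finset.sum_cons]
      exact ((hu.pd a).pd a).add ih
  exact h Finset.univ

theorem norm_gradient_sq (u : 𝔼 → ℝ) (x : 𝔼) : ‖gradient u x‖ ^ 2 = ∑ i, pd i u x ^ 2 := by
  rw [EuclideanSpace.norm_sq_eq]
  refine Finset.sum_congr rfl fun i _ => ?_
  have h : gradient u x i = pd i u x := by
    have := EuclideanSpace.inner_single_right (𝕜 := ℝ) i (1 : ℝ) (gradient u x)
    simp only [gradient, InnerProductSpace.toDual_symm_apply] at this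
    simpa [pd, gradient] using this.symm
  rw [h, Real.norm_eq_abs, sq_abs]

theorem Continuous.integrable_memLp_two {u : 𝔼 → ℝ} (hu : Continuous u)
    (hs : HasCompactSupport u) : Integrable u ∧ MemLp u 2 :=
  ⟨hu.integrable_of_hasCompactSupport hs, hu.memLp_of_hasCompactSupport hs⟩

theorem realFourier_pd {u : 𝔼 → ℝ} (hu : ContDiff ℝ 1 u) (hs : HasCompactSupport u)
    (i : Fin d) (ξ : 𝔼) :
    realFourier (pd i u) ξ = (2 * π * Complex.I * ξ i) * realFourier u ξ := by
  set v : 𝔼 → ℂ := fun x => (u x : ℂ) with hv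
  have hvC : ContDiff ℝ 1 v := Complex.ofRealCLM.contDiff.comp hu
  have hvs : HasCompactSupport v := hs.comp_left (g := fun r : ℝ => (r : ℂ)) (by simp)
  have hvd : Differentiable ℝ v := hvC.differentiable one_ne_zero
  have hfi : Integrable (fderiv ℝ v) :=
    (hvC.continuous_fderiv one_ne_zero).integrable_of_hasCompactSupport (hvs.fderiv ℝ)
  have h := congrFun (Real.fourier_fderiv
    (hvC.continuous.integrable_of_hasCompactSupport hvs) hvd hfi) ξ
  have h' := congrArg (fun L => L (EuclideanSpace.single i (1 : ℝ))) h
  have e1 : (𝓕 (fderiv ℝ v) ξ) (EuclideanSpace.single i (1 : ℝ)) = realFourier (pd i u) ξ := by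
    rw [realFourier, Real.fourier_continuousLinearMap_apply hfi]
    refine congrFun (congrArg 𝓕 (funext fun x => ?_)) ξ
    have := (Complex.ofRealCLM.hasFDerivAt.comp x
      ((hu.differentiable one_ne_zero) x).hasFDerivAt).fderiv
    change fderiv ℝ (Complex.ofRealCLM ∘ u) x _ = _
    rw [this]
    simp [pd]
  rw [← e1, h']
  have e2 : innerSL ℝ ξ (EuclideanSpace.single i (1 : ℝ)) = ξ i := by
    rw [innerSL_apply_apply, EuclideanSpace.inner_single_right]
    simp
  simp only [VectorFourier.fourierSMulRight_apply, neg_apply, e2, realFourier, hv,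
    neg_smul, Complex.real_smul, smul_eq_mul]
  ring

theorem realFourier_lap {u : 𝔼 → ℝ} (hu : ContDiff ℝ 2 u) (hs : HasCompactSupport u) (ξ : 𝔼) :
    realFourier (lap u) ξ = -((4 * π ^ 2 * ‖ξ‖ ^ 2 : ℝ) : ℂ) * realFourier u ξ := by
  have hi : ∀ i, Integrable (fun x => ((pd i (pd i u) x : ℝ) : ℂ)) := fun i =>
    (((hu.pd (m := 1) (by norm_num) i).pd (m := 0) (by norm_num) i).continuous.integrable_memLp_two
      ((hs.pd i).pd i)).1.ofReal
  have h1 : realFourier (lap u) ξ = ∑ i, realFourier (pd i (pd i u)) ξ := by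
    simp only [realFourier, Real.fourier_eq, lap, Complex.ofReal_sum, Finset.smul_sum]
    refine integral_finsetSum _ fun i _ => ?_
    exact (Real.fourierIntegral_convergent_iff ξ).2 (hi i)
  rw [h1, EuclideanSpace.norm_sq_eq]
  simp only [realFourier_pd (hu.pd (m := 1) (by norm_num) _) (hs.pd _),
    realFourier_pd (hu.of_le (by norm_num)) hs]
  push_cast
  rw [Finset.mul_sum, ← Finset.sum_neg_distrib, Finset.sum_mul]
  refine Finset.sum_congr rfl fun i _ => ?_
  have : ((‖ξ i‖ : ℝ) : ℂ) ^ 2 = (ξ i : ℂ) ^ 2 := by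
    rw [← Complex.ofReal_pow, Real.norm_eq_abs, sq_abs, Complex.ofReal_pow]
  rw [this]
  linear_combination (4 * π ^ 2 * ξ i ^ 2 * realFourier u ξ) * Complex.I_sq

theorem integrable_heatK {t : ℝ} (ht : 0 < t) : Integrable (heatK d t) := by
  have h := GaussianFourier.integrable_cexp_neg_mul_sq_norm_add (V := 𝔼)
    (b := ((1 / (4 * t) : ℝ) : ℂ)) (by rw [Complex.ofReal_re]; positivity) 0 0
  have h2 := h.re.const_mul ((4 * π * t) ^ (-(d : ℝ) / 2))
  refine h2.congr (Eventually.of_forall fun x => ?_)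
  have : (-((1 / (4 * t) : ℝ) : ℂ) * (‖x‖ : ℂ) ^ 2 + 0 * (inner ℝ (0 : 𝔼) x : ℝ)) =
      ((-‖x‖ ^ 2 / (4 * t) : ℝ) : ℂ) := by
    push_cast; ring
  simp only [heatK, this, ← Complex.ofReal_exp]
  rfl

theorem continuous_heatK (t : ℝ) : Continuous (heatK d t) := by
  unfold heatK; fun_prop

theorem realFourier_heatK {t : ℝ} (ht : 0 < t) (ξ : 𝔼) :
    realFourier (heatK d t) ξ = ((Real.exp (-(4 * π ^ 2 * ‖ξ‖ ^ 2 * t)) : ℝ) : ℂ) := by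
  have h := fourier_gaussian_innerProductSpace (V := 𝔼)
    (b := ((1 / (4 * t) : ℝ) : ℂ)) (by rw [Complex.ofReal_re]; positivity) ξ
  have e : (fun x => ((heatK d t x : ℝ) : ℂ)) = (((4 * π * t) ^ (-(d : ℝ) / 2) : ℝ) : ℂ) •
      fun v : 𝔼 => Complex.exp (-((1 / (4 * t) : ℝ) : ℂ) * (‖v‖ : ℂ) ^ 2) := by
    funext x
    simp only [heatK, Pi.smul_apply, smul_eq_mul]
    push_cast
    congr 2
    ring
  have hsm : ∀ (c : ℂ) (f : 𝔼 → ℂ), 𝓕 (c • f) ξ = c • 𝓕 f ξ := fun c f =>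
    congrFun (VectorFourier.fourierIntegral_const_smul Real.fourierChar volume (innerₗ 𝔼) f c) ξ
  rw [realFourier, e, hsm, h, smul_eq_mul, ← mul_assoc]
  have hb : (π : ℂ) / ((1 / (4 * t) : ℝ) : ℂ) = ((4 * π * t : ℝ) : ℂ) := by
    push_cast
    field_simp
  have hd : ((Module.finrank ℝ 𝔼 : ℂ) / 2) = (((d : ℝ) / 2 : ℝ) : ℂ) := by
    simp
  rw [hb, hd, ← Complex.ofReal_cpow (by positivity), ← Complex.ofReal_mul,
    ← Real.rpow_add (by positivity)]
  have : -(d : ℝ) / 2 + d / 2 = 0 := by ring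
  rw [this, Real.rpow_zero, Complex.ofReal_one, one_mul, Complex.ofReal_exp]
  congr 1
  push_cast
  have : (t : ℂ) ≠ 0 := by exact_mod_cast ht.ne'
  field_simp

open scoped Convolution

theorem heatConv_eq_convolution (t : ℝ) (u : 𝔼 → ℝ) :
    heatConv t u = (heatK d t ⋆[ContinuousLinearMap.lsmul ℝ ℝ, volume] u) := by
  funext x
  rw [convolution_lsmul_swap]
  rfl

theorem realFourier_heatConv {t : ℝ} (ht : 0 < t) {u : 𝔼 → ℝ} (hu : Integrable u) (ξ : 𝔼) :
    realFourier (heatConv t u) ξ =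
      ((Real.exp (-(4 * π ^ 2 * ‖ξ‖ ^ 2 * t)) : ℝ) : ℂ) * realFourier u ξ := by
  have h := Real.fourier_smul_convolution_eq (f₁ := fun x => ((heatK d t x : ℝ) : ℂ))
    (f₂ := fun x => ((u x : ℝ) : ℂ)) (integrable_heatK ht).ofReal hu.ofReal ξ
  rw [← realFourier_heatK ht, realFourier, realFourier, realFourier, ← smul_eq_mul, ← h]
  refine congrFun (congrArg 𝓕 (funext fun x => ?_)) ξ
  rw [convolution_lsmul_swap, heatConv, ← integral_complex_ofReal]
  simp

theorem heatConv_integrable_memLp_two {t : ℝ} (ht : 0 < t) {u : 𝔼 → ℝ} (hu : Integrable u) :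
    Integrable (heatConv t u) ∧ MemLp (heatConv t u) 2 := by
  have hi : Integrable (heatConv t u) := by
    rw [heatConv_eq_convolution]
    exact (integrable_heatK ht).integrable_convolution _ hu
  refine ⟨hi, (memLp_two_iff_integrable_sq hi.1).2 ?_⟩
  set A : ℝ := (4 * π * t) ^ (-(d : ℝ) / 2) with hA
  have hA0 : 0 ≤ A := by positivity
  have hK : ∀ z : 𝔼, |heatK d t z| ≤ A := by
    intro z
    rw [heatK, abs_mul, abs_of_nonneg hA0, Real.abs_exp]
    refine mul_le_of_le_one_right hA0 (Real.exp_le_one_iff.2 ?_)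
    rw [neg_div]
    exact neg_nonpos.2 (by positivity)
  have hB : ∀ x, |heatConv t u x| ≤ ∫ y, A * |u y| := by
    intro x
    rw [← Real.norm_eq_abs]
    refine norm_integral_le_of_norm_le (hu.abs.const_mul A) (Eventually.of_forall fun y => ?_)
    rw [norm_mul, Real.norm_eq_abs, Real.norm_eq_abs]
    exact mul_le_mul_of_nonneg_right (hK _) (abs_nonneg _)
  refine (hi.abs.const_mul (∫ y, A * |u y|)).mono' (hi.1.pow 2) (Eventually.of_forall fun x => ?_)
  rw [Real.norm_eq_abs, abs_pow, sq]
  exact mul_le_mul_of_nonneg_right (hB x) (abs_nonneg _)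

theorem pd_heatConv {t : ℝ} {u : 𝔼 → ℝ} (hu : ContDiff ℝ 1 u)
    (hs : HasCompactSupport u) (i : Fin d) : pd i (heatConv t u) = heatConv t (pd i u) := by
  funext x
  have hK : LocallyIntegrable (heatK d t) volume := (continuous_heatK t).locallyIntegrable
  rw [pd, heatConv_eq_convolution,
    (hs.hasFDerivAt_convolution_right (ContinuousLinearMap.lsmul ℝ ℝ) hK hu x).fderiv,
    convolution_precompR_apply _ hK (hs.fderiv ℝ) (hu.continuous_fderiv one_ne_zero),
    heatConv_eq_convolution]
  rfl

/-- Spectral representation of the Dirichlet energy. -/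
theorem integral_norm_gradient_sq {u : 𝔼 → ℝ} {G : 𝔼 → ℂ}
    (hu : ∀ i, Integrable (pd i u) ∧ MemLp (pd i u) 2)
    (hG : ∀ i ξ, realFourier (pd i u) ξ = (2 * π * Complex.I * ξ i) * G ξ) :
    Integrable (fun ξ => 4 * π ^ 2 * ‖ξ‖ ^ 2 * ‖G ξ‖ ^ 2) ∧
      ∫ x, ‖gradient u x‖ ^ 2 = ∫ ξ, 4 * π ^ 2 * ‖ξ‖ ^ 2 * ‖G ξ‖ ^ 2 := by
  have hs : (fun ξ => 4 * π ^ 2 * ‖ξ‖ ^ 2 * ‖G ξ‖ ^ 2) =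
      fun ξ => ∑ i, ‖realFourier (pd i u) ξ‖ ^ 2 := by
    funext ξ
    rw [EuclideanSpace.norm_sq_eq, Finset.mul_sum, Finset.sum_mul]
    refine Finset.sum_congr rfl fun i _ => ?_
    rw [hG]
    simp only [norm_mul, mul_pow, Complex.norm_I, Complex.norm_real, Complex.norm_ofNat,
      Real.norm_eq_abs, sq_abs]
    ring
  have hp := fun i => plancherel_real (hu i).1 (hu i).2
  rw [hs]
  refine ⟨integrable_finsetSum _ fun i _ => (hp i).1, ?_⟩
  rw [integral_finsetSum _ fun i _ => (hp i).1]
  simp only [norm_gradient_sq]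
  rw [integral_finsetSum _ fun i _ => (hu i).2.integrable_sq]
  exact Finset.sum_congr rfl fun i _ => (hp i).2.symm

end FourierMultipliers

section LaplaceTransform

variable {α : Type*} [MeasurableSpace α] {μ : Measure α} {l w : α → ℝ}

theorem integrable_exp_neg_mul_mul {g : α → ℝ} (hl : Measurable l) (hl0 : ∀ x, 0 ≤ l x)
    (hg : Integrable g μ) {s : ℝ} (hs : 0 < s) :
    Integrable (fun x => Real.exp (-(s * l x)) * g x) μ := by
  refine hg.norm.mono' ((by fun_prop : Measurable fun x =>
    Real.exp (-(s * l x))).aestronglyMeasurable.mul hg.1) (Eventually.of_forall fun x => ?_)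
  rw [norm_mul, Real.norm_eq_abs, Real.abs_exp]
  exact mul_le_of_le_one_left (norm_nonneg _)
    (Real.exp_le_one_iff.2 (neg_nonpos.2 (mul_nonneg hs.le (hl0 x))))

/-- Jensen's inequality for the Laplace transform of the measure `l w dμ`, in tangent-line form. -/
theorem exp_neg_mul_le_integral (hl : Measurable l) (hl0 : ∀ x, 0 ≤ l x) (hw0 : ∀ x, 0 ≤ w x)
    (h1 : Integrable (fun x => l x * w x) μ) (h2 : Integrable (fun x => l x ^ 2 * w x) μ)
    {a : ℝ} (ha : ∫ x, l x ^ 2 * w x ∂μ = a * ∫ x, l x * w x ∂μ) {s : ℝ} (hs : 0 < s) :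
    Real.exp (-(s * a)) * ∫ x, l x * w x ∂μ ≤ ∫ x, Real.exp (-(s * l x)) * (l x * w x) ∂μ := by
  have hint := integrable_exp_neg_mul_mul hl hl0 h1 hs
  have hlow : ∫ x, Real.exp (-(s * a)) * ((1 + s * a) * (l x * w x) - s * (l x ^ 2 * w x)) ∂μ =
      Real.exp (-(s * a)) * ∫ x, l x * w x ∂μ := by
    rw [integral_const_mul, integral_sub (h1.const_mul _) (h2.const_mul _), integral_const_mul,
      integral_const_mul, ha]
    ring
  rw [← hlow]
  refine integral_mono (((h1.const_mul _).sub (h2.const_mul _)).const_mul _) hint fun x => ?_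
  have h0 : 0 ≤ l x * w x := mul_nonneg (hl0 x) (hw0 x)
  have he : Real.exp (-(s * l x)) = Real.exp (-(s * a)) * Real.exp (s * a - s * l x) := by
    rw [← Real.exp_add]; ring_nf
  have ht := Real.add_one_le_exp (s * a - s * l x)
  calc Real.exp (-(s * a)) * ((1 + s * a) * (l x * w x) - s * (l x ^ 2 * w x))
      = Real.exp (-(s * a)) * ((s * a - s * l x + 1) * (l x * w x)) := by ring
    _ ≤ Real.exp (-(s * a)) * (Real.exp (s * a - s * l x) * (l x * w x)) := by gcongr
    _ = Real.exp (-(s * l x)) * (l x * w x) := by rw [he]; ring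

theorem integrableOn_sq_laplace (hl : Measurable l) (hl0 : ∀ x, 0 ≤ l x) (hw0 : ∀ x, 0 ≤ w x)
    (h0 : Integrable w μ) (h1 : Integrable (fun x => l x * w x) μ) :
    IntegrableOn (fun s : ℝ => (∫ x, Real.exp (-(s * l x)) * (l x * w x) ∂μ) ^ 2)
      (Set.Ioi 0) := by
  set h : ℝ → ℝ := fun s => ∫ x, Real.exp (-(s * l x)) * (l x * w x) ∂μ with hh
  have hlw : ∀ x, 0 ≤ l x * w x := fun x => mul_nonneg (hl0 x) (hw0 x)
  have hint := fun s (hs : 0 < s) => integrable_exp_neg_mul_mul hl hl0 h1 hs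
  have hnn : ∀ s, 0 ≤ h s := fun s =>
    integral_nonneg fun x => mul_nonneg (Real.exp_pos _).le (hlw x)
  have hanti : AntitoneOn h (Set.Ioi 0) := by
    intro s hs t ht hst
    refine integral_mono (hint t ht) (hint s hs) fun x => ?_
    refine mul_le_mul_of_nonneg_right (Real.exp_le_exp.2 ?_) (hlw x)
    exact neg_le_neg (mul_le_mul_of_nonneg_right hst (hl0 x))
  set C : ℝ := ∫ x, (l x * w x + w x) ∂μ with hC
  have hbound : ∀ s, 0 < s → (1 + s) * h s ≤ C := by
    intro s hs
    rw [hh, hC, ← integral_const_mul]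
    refine integral_mono ((hint s hs).const_mul _) (h1.add h0) fun x => ?_
    have hsl : 0 ≤ s * l x := mul_nonneg hs.le (hl0 x)
    have e1 : Real.exp (-(s * l x)) ≤ 1 := Real.exp_le_one_iff.2 (neg_nonpos.2 hsl)
    have e2 : s * l x * Real.exp (-(s * l x)) ≤ 1 := by
      rw [Real.exp_neg, ← div_eq_mul_inv, div_le_one (Real.exp_pos _)]
      linarith [Real.add_one_le_exp (s * l x)]
    have := mul_le_mul_of_nonneg_right e1 (hlw x)
    have := mul_le_mul_of_nonneg_right e2 (hw0 x)
    simp only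
    linarith
  have hC0 : 0 ≤ C := integral_nonneg fun x => add_nonneg (hlw x) (hw0 x)
  refine ((integrable_inv_one_add_sq.const_mul (C ^ 2)).integrableOn (s := Set.Ioi 0)).mono'
    ((aemeasurable_restrict_of_antitoneOn measurableSet_Ioi hanti).pow_const 2).aestronglyMeasurable
    ((ae_restrict_iff' measurableSet_Ioi).2 (Eventually.of_forall fun s hs => ?_))
  have hs : 0 < s := hs
  rw [Real.norm_eq_abs, abs_of_nonneg (sq_nonneg _), ← div_eq_mul_inv, le_div_iff₀ (by positivity)]
  have h3 : ((1 + s) * h s) ^ 2 ≤ C ^ 2 :=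
    pow_le_pow_left₀ (mul_nonneg (by positivity) (hnn s)) (hbound s hs) 2
  nlinarith [mul_nonneg hs.le (sq_nonneg (h s))]

theorem sq_moment_two_le (h1 : Integrable (fun x => l x * w x) μ)
    (hl0 : ∀ x, 0 ≤ l x) (hw0 : ∀ x, 0 ≤ w x)
    (h2 : Integrable (fun x => l x ^ 2 * w x) μ) (h3 : Integrable (fun x => l x ^ 3 * w x) μ) :
    (∫ x, l x ^ 2 * w x ∂μ) ^ 2 ≤ (∫ x, l x * w x ∂μ) * ∫ x, l x ^ 3 * w x ∂μ := by
  have hq : ∀ c : ℝ, 0 ≤ (∫ x, l x * w x ∂μ) * (c * c) +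
      (-2 * ∫ x, l x ^ 2 * w x ∂μ) * c + ∫ x, l x ^ 3 * w x ∂μ := by
    intro c
    have : ∫ x, (l x - c) ^ 2 * (l x * w x) ∂μ = (∫ x, l x * w x ∂μ) * (c * c) +
        (-2 * ∫ x, l x ^ 2 * w x ∂μ) * c + ∫ x, l x ^ 3 * w x ∂μ := by
      have e : (fun x => (l x - c) ^ 2 * (l x * w x)) = fun x =>
          (c * c) * (l x * w x) + (-2 * c) * (l x ^ 2 * w x) + l x ^ 3 * w x := by
        funext x; ring
      have h12 : Integrable (fun x => (c * c) * (l x * w x) + (-2 * c) * (l x ^ 2 * w x)) μ :=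
        (h1.const_mul _).add (h2.const_mul _)
      rw [e, integral_add h12 h3, integral_add (h1.const_mul _) (h2.const_mul _), integral_const_mul, integral_const_mul]
      ring
    rw [← this]
    exact integral_nonneg fun x => mul_nonneg (sq_nonneg _) (mul_nonneg (hl0 x) (hw0 x))
  have := discrim_le_zero hq
  rw [discrim] at this
  nlinarith

theorem moment_ratio_le_integral_sq_laplace (hl : Measurable l) (hl0 : ∀ x, 0 ≤ l x)
    (hw0 : ∀ x, 0 ≤ w x) (h0 : Integrable w μ) (h1 : Integrable (fun x => l x * w x) μ)
    (h2 : Integrable (fun x => l x ^ 2 * w x) μ) (h3 : Integrable (fun x => l x ^ 3 * w x) μ) :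
    (∫ x, l x * w x ∂μ) ^ 2 * (∫ x, l x ^ 2 * w x ∂μ) / (∫ x, l x ^ 3 * w x ∂μ) ≤
      2 * ∫ s in Set.Ioi (0 : ℝ), (∫ x, Real.exp (-(s * l x)) * (l x * w x) ∂μ) ^ 2 := by
  have hcs := sq_moment_two_le h1 hl0 hw0 h2 h3
  have hJ := fun {a : ℝ} ha {s : ℝ} (hs : 0 < s) =>
    exp_neg_mul_le_integral hl hl0 hw0 h1 h2 (a := a) ha hs
  set M₁ := ∫ x, l x * w x ∂μ
  set M₂ := ∫ x, l x ^ 2 * w x ∂μ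
  set M₃ := ∫ x, l x ^ 3 * w x ∂μ
  have p1 : 0 ≤ M₁ := integral_nonneg fun x => mul_nonneg (hl0 x) (hw0 x)
  have p2 : 0 ≤ M₂ := integral_nonneg fun x => mul_nonneg (sq_nonneg _) (hw0 x)
  have p3 : 0 ≤ M₃ := integral_nonneg fun x => mul_nonneg (pow_nonneg (hl0 x) _) (hw0 x)
  have hLHS : 0 ≤ 2 * ∫ s in Set.Ioi (0 : ℝ),
      (∫ x, Real.exp (-(s * l x)) * (l x * w x) ∂μ) ^ 2 :=
    mul_nonneg zero_le_two (integral_nonneg fun s => sq_nonneg _)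
  rcases p1.eq_or_lt with z1 | q1
  · simpa [← z1] using hLHS
  rcases p2.eq_or_lt with z2 | q2
  · simpa [← z2] using hLHS
  rcases p3.eq_or_lt with z3 | q3
  · simpa [← z3] using hLHS
  set a := M₂ / M₁
  have ha : 0 < a := div_pos q2 q1
  have haM : M₂ = a * M₁ := (div_mul_cancel₀ _ q1.ne').symm
  have hexp : ∫ s in Set.Ioi (0 : ℝ), Real.exp (-(2 * a) * s) * M₁ ^ 2 =
      M₁ ^ 2 / (2 * a) := by
    rw [integral_mul_const, integral_exp_mul_Ioi (by linarith)]
    simp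
    field_simp
  have hmono : M₁ ^ 2 / (2 * a) ≤ ∫ s in Set.Ioi (0 : ℝ),
      (∫ x, Real.exp (-(s * l x)) * (l x * w x) ∂μ) ^ 2 := by
    rw [← hexp]
    refine setIntegral_mono_on ((integrableOn_exp_mul_Ioi (by linarith) 0).mul_const _)
      (integrableOn_sq_laplace hl hl0 hw0 h0 h1) measurableSet_Ioi fun s hs => ?_
    have := pow_le_pow_left₀ (mul_nonneg (Real.exp_pos _).le p1) (hJ haM hs) 2
    refine le_trans (le_of_eq ?_) this
    rw [mul_pow, ← Real.exp_nat_mul]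
    push_cast
    ring_nf
  calc M₁ ^ 2 * M₂ / M₃ ≤ M₁ ^ 2 / a := by
        rw [div_le_div_iff₀ q3 ha]
        have : M₂ * a ≤ M₃ := by
          rw [← mul_div_assoc, div_le_iff₀ q1]
          linarith
        nlinarith [mul_le_mul_of_nonneg_left this (sq_nonneg M₁)]
    _ = 2 * (M₁ ^ 2 / (2 * a)) := by field_simp
    _ ≤ _ := by gcongr

end LaplaceTransform

/-- Variance comparison lemma (Section 5.2): with `K = ΔK̃`,
`2 ∫₀^∞ ‖∇(e^{(s/2)Δ}K̃)‖⁴_{L²} ds ≥ ‖∇K̃‖⁴_{L²} ‖K‖²_{L²} / ‖∇K‖²_{L²}`,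
i.e. `Σ^P ≥ Σ^A`. -/
theorem stmt13 {d : ℕ} (hd : 1 ≤ d)
    (Kt : EuclideanSpace ℝ (Fin d) → ℝ) (hKt : ContDiff ℝ 4 Kt)
    (hsupp : HasCompactSupport Kt) (hne : Kt ≠ 0) :
    2 * ∫ s in Set.Ioi (0 : ℝ), (∫ x, ‖gradient (heatConv (s / 2) Kt) x‖ ^ 2) ^ 2
      ≥ (∫ x, ‖gradient Kt x‖ ^ 2) ^ 2 * (∫ x, (lap Kt x) ^ 2)
          / (∫ x, ‖gradient (lap Kt) x‖ ^ 2) := by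
  have hC1 : ContDiff ℝ 1 Kt := hKt.of_le (by norm_num)
  have hC2 : ContDiff ℝ 2 Kt := hKt.of_le (by norm_num)
  have hL1 : ContDiff ℝ 1 (lap Kt) := hKt.lap (by norm_num)
  have hpd : ∀ {u : EuclideanSpace ℝ (Fin d) → ℝ}, ContDiff ℝ 1 u → HasCompactSupport u →
      ∀ i, Integrable (pd i u) ∧ MemLp (pd i u) 2 := fun hu hs i =>
    (hu.pd (m := 0) (by norm_num) i).continuous.integrable_memLp_two (hs.pd i)
  set l : EuclideanSpace ℝ (Fin d) → ℝ := fun ξ => 4 * π ^ 2 * ‖ξ‖ ^ 2 with hl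
  set w : EuclideanSpace ℝ (Fin d) → ℝ := fun ξ => ‖realFourier Kt ξ‖ ^ 2 with hw
  have hl0 : ∀ ξ, 0 ≤ l ξ := fun ξ => by positivity
  have hw0 : ∀ ξ, 0 ≤ w ξ := fun ξ => by positivity
  have hK := hC1.continuous.integrable_memLp_two hsupp
  have hΔ := hL1.continuous.integrable_memLp_two hsupp.lap
  have hFΔ : ∀ ξ, realFourier (lap Kt) ξ = -((l ξ : ℝ) : ℂ) * realFourier Kt ξ :=
    realFourier_lap hC2 hsupp
  have hnΔ : ∀ ξ, ‖realFourier (lap Kt) ξ‖ ^ 2 = l ξ ^ 2 * w ξ := fun ξ => by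
    rw [hFΔ, norm_mul, norm_neg, Complex.norm_real, Real.norm_eq_abs, mul_pow, sq_abs]
  have h0 := (plancherel_real hK.1 hK.2).1
  have h1 := integral_norm_gradient_sq (hpd hC1 hsupp) (realFourier_pd hC1 hsupp)
  have h2 := plancherel_real hΔ.1 hΔ.2
  have h3 := integral_norm_gradient_sq (hpd hL1 hsupp.lap) (realFourier_pd hL1 hsupp.lap)
  have e3 : ∀ ξ, 4 * π ^ 2 * ‖ξ‖ ^ 2 * (l ξ ^ 2 * w ξ) = l ξ ^ 3 * w ξ := fun ξ => by
    simp only [hl]; ring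
  simp only [hnΔ, e3] at h2 h3
  have hheat : ∀ s ∈ Set.Ioi (0 : ℝ), (∫ x, ‖gradient (heatConv (s / 2) Kt) x‖ ^ 2) ^ 2 =
      (∫ ξ, Real.exp (-(s * l ξ)) * (l ξ * w ξ)) ^ 2 := by
    intro s hs
    have hs2 : 0 < s / 2 := half_pos hs
    have h := integral_norm_gradient_sq (u := heatConv (s / 2) Kt)
      (G := realFourier (heatConv (s / 2) Kt))
      (fun i => by
        rw [pd_heatConv hC1 hsupp]
        exact heatConv_integrable_memLp_two hs2 (hpd hC1 hsupp i).1)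
      (fun i ξ => by
        rw [pd_heatConv hC1 hsupp, realFourier_heatConv hs2 (hpd hC1 hsupp i).1,
          realFourier_heatConv hs2 hK.1, realFourier_pd hC1 hsupp]
        ring)
    rw [h.2]
    congr 1
    refine integral_congr_ae (Eventually.of_forall fun ξ => ?_)
    have he : Real.exp (-(s * l ξ)) = Real.exp (-(4 * π ^ 2 * ‖ξ‖ ^ 2 * (s / 2))) ^ 2 := by
      rw [← Real.exp_nat_mul]
      congr 1
      simp only [hl]
      push_cast
      ring
    simp only [realFourier_heatConv hs2 hK.1, norm_mul, Complex.norm_real, Real.norm_eq_abs,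
      Real.abs_exp, he, hw]
    simp only [hl]
    ring
  rw [setIntegral_congr_fun measurableSet_Ioi hheat, h1.2, ← h2.2, h3.2]
  exact moment_ratio_le_integral_sq_laplace (by fun_prop) hl0 hw0 h0 h1.1 h2.1 h3.1
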